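/- Let Γ be a group, (𝔾, s, t) ∈ 𝒟, and let X ⊆ V(𝔾)∖{s,t} be a 2-contractible vertex set in 𝔾. Then (𝔾 /₂ X, s, t) ∈ 𝒟 and l(𝔾 /₂ X; s, t) = l(𝔾; s, t). -/

import Mathlib

/-- A Γ-labeled graph: a finite loopless directed multigraph with arcs labeled by
elements of a group Γ.  An arc is represented as a triple `(tail, head, label)`. -/
structure LGraph (V : Type) (Γ : Type) [Group Γ] where
  verts : Set V
  arcs : Set (V × V × Γ)
  verts_finite : verts.Finite
  arcs_finite : arcs.Finite
  tail_mem : ∀ a ∈ arcs, a.1 ∈ verts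
  head_mem : ∀ a ∈ arcs, a.2.1 ∈ verts
  loopless : ∀ a ∈ arcs, a.1 ≠ a.2.1

namespace LGraph

variable {V : Type} {Γ : Type} [Group Γ]

/-- `connects a u v` : the arc `a` joins `u` and `v` (traversed from `u` to `v`,
in either direction of the arc). -/
def connects (a : V × V × Γ) (u v : V) : Prop :=
  (a.1 = u ∧ a.2.1 = v) ∨ (a.1 = v ∧ a.2.1 = u)

/-- Walks in the underlying undirected graph of a Γ-labeled graph. -/
inductive Walk (G : LGraph V Γ) : V → V → Type
  | nil (v : V) : Walk G v v
  | cons (u v : V) {w : V} (a : V × V × Γ) (ha : a ∈ G.arcs)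
      (hstep : connects a u v) (W : Walk G v w) : Walk G u w

variable [DecidableEq V]

/-- `ψ_𝔾(e, v)` : the label contributed by arc `a` when traversed arriving at `v` :
the arc's label if the arc enters `v`, its inverse if it leaves `v`. -/
def stepLabel (v : V) (a : V × V × Γ) : Γ :=
  if a.2.1 = v then a.2.2 else a.2.2⁻¹

namespace Walk

variable {G : LGraph V Γ}

/-- The label `ψ_𝔾(W)` of a walk: the product of the step labels, later steps
multiplied on the left. -/
def label : {u w : V} → G.Walk u w → Γ
  | _, _, .nil _ => 1
  | _, _, .cons _ v a _ _ W => label W * stepLabel v a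

/-- The list of vertices of a walk, in order. -/
def support : {u w : V} → G.Walk u w → List V
  | _, _, .nil v => [v]
  | _, _, .cons u _ _ _ _ W => u :: support W

/-- The list of traversed arcs of a walk, in order. -/
def arcsList : {u w : V} → G.Walk u w → List (V × V × Γ)
  | _, _, .nil _ => []
  | _, _, .cons _ _ a _ _ W => a :: arcsList W

/-- The length (number of edges) of a walk. -/
def length : {u w : V} → G.Walk u w → ℕ
  | _, _, .nil _ => 0
  | _, _, .cons _ _ _ _ _ W => length W + 1

/-- A walk is a path if all its vertices are distinct. -/
def IsPath {u w : V} (W : G.Walk u w) : Prop := W.support.Nodup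

/-- A closed walk is a cycle if it is nonempty, its edges are distinct and its
vertices (except for the repeated end vertex) are distinct. -/
def IsCycle {v : V} (W : G.Walk v v) : Prop :=
  1 ≤ W.length ∧ W.arcsList.Nodup ∧ W.support.dropLast.Nodup

end Walk

/-- `l(𝔾; s, t)` : the set of all labels of s–t paths in `G`. -/
def labelSet (G : LGraph V Γ) (s t : V) : Set Γ :=
  {γ | ∃ P : G.Walk s t, P.IsPath ∧ P.label = γ}

/-- A Γ-labeled graph is balanced if every cycle has label `1`. -/
def Balanced (G : LGraph V Γ) : Prop :=
  ∀ (v : V) (C : G.Walk v v), C.IsCycle → C.label = 1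

/-- Connectivity of (the underlying graph of) a Γ-labeled graph. -/
def Connected (G : LGraph V Γ) : Prop :=
  ∀ u ∈ G.verts, ∀ w ∈ G.verts, Nonempty (G.Walk u w)

/-- `G` has no pair of equivalent arcs: no two distinct arcs that are parallel with
the same label, or antiparallel with mutually inverse labels. -/
def NoEquivArcs (G : LGraph V Γ) : Prop :=
  ∀ a ∈ G.arcs, ∀ b ∈ G.arcs, a ≠ b →
    ¬ ((a.1 = b.1 ∧ a.2.1 = b.2.1 ∧ a.2.2 = b.2.2) ∨
       (a.1 = b.2.1 ∧ a.2.1 = b.1 ∧ a.2.2 = b.2.2⁻¹))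

/-- `(𝔾, s, t) ∈ 𝒟` : `s, t` are distinct vertices, every vertex lies on some
s–t path, and there are no equivalent arcs. -/
def MemD (G : LGraph V Γ) (s t : V) : Prop :=
  s ≠ t ∧ s ∈ G.verts ∧ t ∈ G.verts ∧
  (∀ v ∈ G.verts, ∃ P : G.Walk s t, P.IsPath ∧ v ∈ P.support) ∧
  G.NoEquivArcs

/-- `(s,t)`-equivalence: `H` is obtained from `G` by shifting by `φ v` at each
vertex `v`, where `φ` vanishes at `s` and `t`. -/
def STEquiv (s t : V) (G H : LGraph V Γ) : Prop :=
  ∃ φ : V → Γ, φ s = 1 ∧ φ t = 1 ∧ H.verts = G.verts ∧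
    H.arcs = (fun a : V × V × Γ => (a.1, a.2.1, φ a.2.1 * a.2.2 * (φ a.1)⁻¹)) '' G.arcs

/-- The subgraph induced by a vertex set `X`. -/
def induce (G : LGraph V Γ) (X : Set V) : LGraph V Γ where
  verts := G.verts ∩ X
  arcs := {a ∈ G.arcs | a.1 ∈ X ∧ a.2.1 ∈ X}
  verts_finite := G.verts_finite.subset Set.inter_subset_left
  arcs_finite := G.arcs_finite.subset fun _ ha => ha.1
  tail_mem := fun a ha => ⟨G.tail_mem a ha.1, ha.2.1⟩
  head_mem := fun a ha => ⟨G.head_mem a ha.1, ha.2.2⟩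
  loopless := fun a ha => G.loopless a ha.1

/-- `𝔾 − Y` : deletion of the vertex set `Y`. -/
def delete (G : LGraph V Γ) (Y : Set V) : LGraph V Γ := G.induce Yᶜ

/-- `N_𝔾(X)` : the set of vertices outside `X` adjacent to `X`. -/
def nbhd (G : LGraph V Γ) (X : Set V) : Set V :=
  {y | y ∉ X ∧ ∃ x ∈ X, ∃ a ∈ G.arcs, connects a x y}

/-- `𝔾⟦X⟧` : the subgraph induced by `X ∪ N(X)` with the edges inside `N(X)` removed. -/
def around (G : LGraph V Γ) (X : Set V) : LGraph V Γ where
  verts := G.verts ∩ (X ∪ G.nbhd X)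
  arcs := {a ∈ G.arcs | (a.1 ∈ X ∪ G.nbhd X) ∧ (a.2.1 ∈ X ∪ G.nbhd X) ∧
            ¬ (a.1 ∈ G.nbhd X ∧ a.2.1 ∈ G.nbhd X)}
  verts_finite := G.verts_finite.subset Set.inter_subset_left
  arcs_finite := G.arcs_finite.subset fun _ ha => ha.1
  tail_mem := fun a ha => ⟨G.tail_mem a ha.1, ha.2.1⟩
  head_mem := fun a ha => ⟨G.head_mem a ha.1, ha.2.2.1⟩
  loopless := fun a ha => G.loopless a ha.1

/-- The arcs of `G` surviving the removal of the vertex set `X`. -/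
def keptArcs (G : LGraph V Γ) (X : Set V) : Set (V × V × Γ) :=
  {a ∈ G.arcs | a.1 ∉ X ∧ a.2.1 ∉ X}

/-- `A` contains an arc equivalent to an arc from `x` to `y` with label `γ`. -/
def hasEquivArc (A : Set (V × V × Γ)) (x y : V) (γ : Γ) : Prop :=
  (x, y, γ) ∈ A ∨ (y, x, γ⁻¹) ∈ A

/-- The new arcs added by a contraction of `X`, between `x` and `y`: an arc from `x`
to `y` with label `γ` for each `γ ∈ l(𝔾⟦X⟧; x, y)`, unless an equivalent arc
already exists among the kept arcs. -/
def newContractionArcs (G : LGraph V Γ) (X : Set V) (x y : V) : Set (V × V × Γ) :=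
  {p | ∃ γ ∈ labelSet (G.around X) x y, p = (x, y, γ) ∧ ¬ hasEquivArc (G.keptArcs X) x y γ}

/-- The arc set of the 2-contraction `𝔾 /₂ X`, where `N_𝔾(X) = {x, y}`. -/
def contract2Arcs (G : LGraph V Γ) (X : Set V) (x y : V) : Set (V × V × Γ) :=
  G.keptArcs X ∪ G.newContractionArcs X x y

/-- The arc set of the 3-contraction `𝔾 /₃ X`, where `N_𝔾(X) = {x, y, z}`. -/
def contract3Arcs (G : LGraph V Γ) (X : Set V) (x y z : V) : Set (V × V × Γ) :=
  G.keptArcs X ∪ G.newContractionArcs X x y ∪ G.newContractionArcs X y z ∪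
    G.newContractionArcs X x z

/-- `X` is 2-contractible in `𝔾` (w.r.t. the terminals `s, t`). -/
def TwoContractible (G : LGraph V Γ) (s t : V) (X : Set V) : Prop :=
  X ⊆ G.verts \ {s, t} ∧
  (∃ x y : V, x ≠ y ∧ G.nbhd X = {x, y}) ∧
  (G.around X).Connected ∧ G.around X ≠ G

/-- `X` is 3-contractible in `𝔾` (w.r.t. the terminals `s, t`). -/
def ThreeContractible (G : LGraph V Γ) (s t : V) (X : Set V) : Prop :=
  X ⊆ G.verts \ {s, t} ∧
  (∃ x y z : V, x ≠ y ∧ x ≠ z ∧ y ≠ z ∧ G.nbhd X = {x, y, z}) ∧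
  (G.induce X).Connected ∧ (G.around X).Balanced

/-- The graph obtained by adding a single `s`–`t` edge (with an arbitrary label). -/
def addEdge (G : LGraph V Γ) (s t : V) (hs : s ∈ G.verts) (ht : t ∈ G.verts)
    (hst : s ≠ t) : LGraph V Γ where
  verts := G.verts
  arcs := insert (s, t, (1 : Γ)) G.arcs
  verts_finite := G.verts_finite
  arcs_finite := G.arcs_finite.insert _
  tail_mem := by
    intro a ha
    rcases Set.mem_insert_iff.mp ha with rfl | h
    · exact hs
    · exact G.tail_mem a h
  head_mem := by
    intro a ha
    rcases Set.mem_insert_iff.mp ha with rfl | h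
    · exact ht
    · exact G.head_mem a h
  loopless := by
    intro a ha
    rcases Set.mem_insert_iff.mp ha with rfl | h
    · exact hst
    · exact G.loopless a h

/-- 2-connectivity: more than 2 vertices, and removing any single vertex leaves
the graph connected. -/
def TwoConnected (G : LGraph V Γ) : Prop :=
  2 < G.verts.ncard ∧ ∀ v : V, (G.delete {v}).Connected

/-- The effect of shifting by `α` at `v` on a single arc. -/
def shiftArc (v : V) (α : Γ) (a : V × V × Γ) : V × V × Γ :=
  (a.1, a.2.1, if a.2.1 = v then α * a.2.2 else if a.1 = v then a.2.2 * α⁻¹ else a.2.2)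

/-- The graph obtained from `G` by shifting by `α` at `v`. -/
def shift (G : LGraph V Γ) (v : V) (α : Γ) : LGraph V Γ where
  verts := G.verts
  arcs := shiftArc v α '' G.arcs
  verts_finite := G.verts_finite
  arcs_finite := G.arcs_finite.image _
  tail_mem := by rintro a ⟨b, hb, rfl⟩; exact G.tail_mem b hb
  head_mem := by rintro a ⟨b, hb, rfl⟩; exact G.head_mem b hb
  loopless := by rintro a ⟨b, hb, rfl⟩; exact G.loopless b hb

/-- The walk in `G.shift v α` corresponding to a walk in `G`. -/
def Walk.shiftMap {G : LGraph V Γ} (v : V) (α : Γ) :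
    {u w : V} → G.Walk u w → (G.shift v α).Walk u w
  | _, _, .nil x => .nil x
  | _, _, .cons u x a ha hstep W =>
      .cons u x (shiftArc v α a) (Set.mem_image_of_mem _ ha) hstep (Walk.shiftMap v α W)

end LGraph
namespace LGraph

variable {V : Type} {Γ : Type}

theorem connects.symm {a : V × V × Γ} {u v : V} (h : connects a u v) : connects a v u :=
  Or.symm h

variable [Group Γ]

namespace Walk

variable {G : LGraph V Γ}

theorem start_mem_support {u w : V} (W : G.Walk u w) : u ∈ W.support := by
  cases W <;> simp [support]

theorem support_eq_cons {u w : V} (W : G.Walk u w) : W.support = u :: W.support.tail := by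
  cases W <;> simp [support]

theorem support_subset_verts {u w : V} (W : G.Walk u w) (hu : u ∈ G.verts) :
    ∀ v ∈ W.support, v ∈ G.verts := by
  induction W with
  | nil v => simpa [support] using hu
  | cons u v a ha h W ih =>
    have hv : v ∈ G.verts := by
      rcases h with ⟨-, rfl⟩ | ⟨rfl, -⟩
      · exact G.head_mem a ha
      · exact G.tail_mem a ha
    simpa [support, hu] using ih hv

end Walk

/-- An arc of `𝔾` with an end in `X` is an arc of `𝔾⟦X⟧`. -/
theorem mem_around_arcs {G : LGraph V Γ} {X : Set V} {a : V × V × Γ} (ha : a ∈ G.arcs) {u v : V}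
    (h : connects a u v) (hu : u ∈ X) : a ∈ (G.around X).arcs := by
  have hv : v ∈ X ∪ G.nbhd X := by
    by_cases hv : v ∈ X
    · exact Or.inl hv
    · exact Or.inr ⟨hv, u, hu, a, ha, h⟩
  have hu' : u ∉ G.nbhd X := fun h => h.1 hu
  rcases h with ⟨rfl, rfl⟩ | ⟨rfl, rfl⟩
  · exact ⟨ha, Or.inl hu, hv, fun h => hu' h.1⟩
  · exact ⟨ha, hv, Or.inl hu, fun h => hu' h.2⟩

variable [DecidableEq V]

theorem stepLabel_symm {a : V × V × Γ} {u v : V} (h : connects a u v) (ha : a.1 ≠ a.2.1) :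
    stepLabel u a = (stepLabel v a)⁻¹ := by
  unfold stepLabel
  rcases h with ⟨rfl, rfl⟩ | ⟨rfl, rfl⟩
  · simp [ha.symm]
  · simp [ha.symm]

namespace Walk

variable {G : LGraph V Γ}

/-- A walk in a subgraph is a walk in the larger graph. -/
theorem exists_of_arcs_subset {G' : LGraph V Γ} (hG : G.arcs ⊆ G'.arcs) {u w : V}
    (W : G.Walk u w) :
    ∃ W' : G'.Walk u w, W'.support = W.support ∧ W'.label = W.label := by
  induction W with
  | nil v => exact ⟨.nil v, rfl, rfl⟩
  | cons u v a ha h W ih =>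
    obtain ⟨W', hs, hl⟩ := ih
    exact ⟨.cons u v a (hG ha) h W', by simp [support, hs], by simp [label, hl]⟩

theorem exists_append {u v w : V} (P : G.Walk u v) (Q : G.Walk v w) :
    ∃ R : G.Walk u w, R.support = P.support ++ Q.support.tail ∧ R.label = Q.label * P.label := by
  induction P with
  | nil v => exact ⟨Q, by simpa [support] using Q.support_eq_cons, by simp [label]⟩
  | cons u v a ha h P ih =>
    obtain ⟨R, hs, hl⟩ := ih Q
    exact ⟨.cons u v a ha h R, by simp [support, hs], by simp [label, hl, mul_assoc]⟩

theorem exists_reverse {u w : V} (W : G.Walk u w) :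
    ∃ R : G.Walk w u, R.support = W.support.reverse ∧ R.label = W.label⁻¹ := by
  induction W with
  | nil v => exact ⟨.nil v, by simp [support], by simp [label]⟩
  | cons u v a ha h W ih =>
    obtain ⟨R, hs, hl⟩ := ih
    obtain ⟨R', hs', hl'⟩ := R.exists_append (.cons v u a ha h.symm (.nil u))
    refine ⟨R', by simp [hs', hs, support], ?_⟩
    simp [hl', hl, label, stepLabel_symm h (G.loopless a ha)]

end Walk

theorem inv_mem_labelSet {G : LGraph V Γ} {s t : V} {γ : Γ} (h : γ ∈ labelSet G s t) :
    γ⁻¹ ∈ labelSet G t s := by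
  obtain ⟨P, hP, rfl⟩ := h
  obtain ⟨R, hs, hl⟩ := P.exists_reverse
  exact ⟨R, by simpa [Walk.IsPath, hs] using hP, hl⟩

/-- In `𝔾 /₂ X`, every label of an `x`–`y` path of `𝔾⟦X⟧` is the label of an edge. -/
theorem exists_arc_of_mem_labelSet_around {G H : LGraph V Γ} {X : Set V} {x y : V} (hxy : x ≠ y)
    (hHa : H.arcs = G.contract2Arcs X x y) {γ : Γ} (hγ : γ ∈ labelSet (G.around X) x y) :
    ∃ a ∈ H.arcs, connects a x y ∧ stepLabel y a = γ := by
  rw [hHa]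
  by_cases h : hasEquivArc (G.keptArcs X) x y γ
  · rcases h with h | h
    · exact ⟨_, Or.inl h, Or.inl ⟨rfl, rfl⟩, by simp [stepLabel]⟩
    · exact ⟨_, Or.inl h, Or.inr ⟨rfl, rfl⟩, by simp [stepLabel, hxy]⟩
  · exact ⟨(x, y, γ), Or.inr ⟨γ, hγ, rfl, h⟩, Or.inl ⟨rfl, rfl⟩, by simp [stepLabel]⟩

theorem exists_arc_of_mem_labelSet_around_of_nbhd {G H : LGraph V Γ} {X : Set V} {x y : V}
    (hxy : x ≠ y) (hN : G.nbhd X = {x, y}) (hHa : H.arcs = G.contract2Arcs X x y) {u z : V}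
    (hu : u ∈ G.nbhd X) (hz : z ∈ G.nbhd X) (huz : u ≠ z) {γ : Γ}
    (hγ : γ ∈ labelSet (G.around X) u z) :
    ∃ a ∈ H.arcs, connects a u z ∧ stepLabel z a = γ := by
  rw [hN] at hu hz
  rcases hu with rfl | rfl <;> rcases hz with rfl | rfl
  · exact absurd rfl huz
  · exact exists_arc_of_mem_labelSet_around hxy hHa hγ
  · obtain ⟨a, ha, hc, hl⟩ := exists_arc_of_mem_labelSet_around hxy hHa (inv_mem_labelSet hγ)
    exact ⟨a, ha, hc.symm, by rw [stepLabel_symm hc (H.loopless a ha), hl, inv_inv]⟩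
  · exact absurd rfl huz

/-- A path of `𝔾` ending outside `X` yields a path of `𝔾 /₂ X` with the same label and the same
vertices outside `X`; when it starts in `X`, it first has to leave `X` along a path of `𝔾⟦X⟧`. -/
theorem Walk.exists_contract {G H : LGraph V Γ} {X : Set V} {x y : V} (hxy : x ≠ y)
    (hN : G.nbhd X = {x, y}) (hHa : H.arcs = G.contract2Arcs X x y) {u t : V} (W : G.Walk u t)
    (ht : t ∉ X) (hW : W.IsPath) :
    (u ∉ X → ∃ R : H.Walk u t, R.IsPath ∧ R.label = W.label ∧
      ∀ v, v ∈ R.support ↔ v ∈ W.support ∧ v ∉ X) ∧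
    (u ∈ X → ∃ z ∈ G.nbhd X, ∃ (Q : (G.around X).Walk u z) (R : H.Walk z t),
      Q.IsPath ∧ (∀ v ∈ Q.support, v ∈ W.support) ∧ R.IsPath ∧
      R.label * Q.label = W.label ∧ ∀ v, v ∈ R.support ↔ v ∈ W.support ∧ v ∉ X) := by
  induction W with
  | nil v =>
    refine ⟨fun _ => ⟨.nil v, hW, rfl, ?_⟩, fun h => absurd h ht⟩
    simp only [support, List.mem_singleton]
    grind
  | cons u v a ha h W ih =>
    obtain ⟨huW, hW'⟩ : u ∉ W.support ∧ W.IsPath := by simpa [IsPath, support] using hW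
    obtain ⟨ih₁, ih₂⟩ := ih ht hW'
    by_cases hv : v ∈ X
    · obtain ⟨z, hz, Q, R, hQ, hQW, hR, hl, hs⟩ := ih₂ hv
      have haX := mem_around_arcs ha h.symm hv
      have hQ' : (Walk.cons u v a haX h Q).IsPath := by
        simpa [IsPath, support] using ⟨fun hm => huW (hQW u hm), hQ⟩
      refine ⟨fun hu => ?_, fun hu => ?_⟩
      · have hzW := ((hs z).1 R.start_mem_support).1
        have huz : u ≠ z := fun e => huW (e ▸ hzW)
        obtain ⟨b, hb, hbc, hbl⟩ := exists_arc_of_mem_labelSet_around_of_nbhd hxy hN hHa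
          ⟨hu, v, hv, a, ha, h.symm⟩ hz huz ⟨_, hQ', rfl⟩
        refine ⟨.cons u z b hb hbc R, ?_, ?_, ?_⟩
        · simpa [IsPath, support] using ⟨fun hm => huW ((hs u).1 hm).1, hR⟩
        · simp [label, hbl, ← hl, mul_assoc]
        · intro w
          simp only [support, List.mem_cons, hs w]
          grind
      · refine ⟨z, hz, .cons u v a haX h Q, R, hQ', ?_, hR, ?_, ?_⟩
        · intro w
          simp only [support, List.mem_cons]
          exact Or.imp_right (hQW w)
        · simp [label, ← hl, mul_assoc]
        · intro w
          simp only [support, List.mem_cons, hs w]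
          grind
    · obtain ⟨R, hR, hl, hs⟩ := ih₁ hv
      refine ⟨fun hu => ?_, fun hu => ?_⟩
      · have hb : a ∈ H.arcs := by
          rw [hHa]
          refine Or.inl ⟨ha, ?_⟩
          rcases h with ⟨rfl, rfl⟩ | ⟨rfl, rfl⟩
          exacts [⟨hu, hv⟩, ⟨hv, hu⟩]
        refine ⟨.cons u v a hb h R, ?_, by simp [label, hl], ?_⟩
        · simpa [IsPath, support] using ⟨fun hm => huW ((hs u).1 hm).1, hR⟩
        · intro w
          simp only [support, List.mem_cons, hs w]
          grind
      · refine ⟨v, ⟨hv, u, hu, a, ha, h⟩, .cons u v a (mem_around_arcs ha h hu) h (.nil v), R,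
          ?_, ?_, hR, ?_, ?_⟩
        · have : u ≠ v := fun e => hv (e ▸ hu)
          simpa [IsPath, support] using this
        · have := W.start_mem_support
          simp only [support, List.mem_cons, List.not_mem_nil]
          grind
        · simp [label, hl]
        · intro w
          simp only [support, List.mem_cons, hs w]
          grind

/-- A path of `𝔾 /₂ X` yields a path of `𝔾` with the same label, which visits `X` only if the
original path contains both `x` and `y`. -/
theorem Walk.exists_expand {G H : LGraph V Γ} {X : Set V} {x y : V}
    (hN : G.nbhd X = {x, y}) (hHv : H.verts = G.verts \ X)
    (hHa : H.arcs = G.contract2Arcs X x y) {u t : V} (W : H.Walk u t)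
    (hu : u ∈ H.verts) (hW : W.IsPath) :
    ∃ R : G.Walk u t, R.IsPath ∧ R.label = W.label ∧
      ∀ v ∈ R.support, v ∈ W.support ∨ v ∈ X ∧ x ∈ W.support ∧ y ∈ W.support := by
  induction W with
  | nil v => exact ⟨.nil v, hW, rfl, fun _ => Or.inl⟩
  | cons u v a ha h W ih =>
    obtain ⟨huW, hW'⟩ : u ∉ W.support ∧ W.IsPath := by simpa [IsPath, support] using hW
    have hv : v ∈ H.verts := by
      rcases h with ⟨-, rfl⟩ | ⟨rfl, -⟩
      exacts [H.head_mem a ha, H.tail_mem a ha]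
    obtain ⟨R, hR, hl, hs⟩ := ih hv hW'
    have huX : u ∉ X := by rw [hHv] at hu; exact hu.2
    have hWX : ∀ w ∈ W.support, w ∉ X := fun w hw => by
      have := W.support_subset_verts hv w hw
      rw [hHv] at this
      exact this.2
    have hvW := W.start_mem_support
    have ha' := ha
    rw [hHa] at ha'
    rcases ha' with ha' | ⟨γ, hγ, rfl, -⟩
    · refine ⟨.cons u v a ha'.1 h R, ?_, by simp [label, hl], ?_⟩
      · have : u ∉ R.support := by grind
        simpa [IsPath, support] using ⟨this, hR⟩
      · simp only [support, List.mem_cons]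
        grind
    · have hne : x ≠ y := H.loopless _ ha
      have hγ' : stepLabel v (x, y, γ) ∈ labelSet (G.around X) u v := by
        rcases h with ⟨rfl, rfl⟩ | ⟨rfl, rfl⟩
        · simpa [stepLabel] using hγ
        · simpa [stepLabel, hne.symm] using inv_mem_labelSet hγ
      have hends : x = u ∧ y = v ∨ x = v ∧ y = u := h
      obtain ⟨P, hP, hPl⟩ := hγ'
      have huN : u ∈ (G.around X).verts := by
        rw [hHv] at hu
        refine ⟨hu.1, Or.inr ?_⟩
        rw [hN]
        grind
      have hPs : ∀ w ∈ P.support, w ∈ X ∨ w = x ∨ w = y := fun w hw => by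
        have := (P.support_subset_verts huN w hw).2
        rw [hN] at this
        exact this
      obtain ⟨P', hP's, hP'l⟩ := P.exists_of_arcs_subset (G' := G) (Set.sep_subset _ _)
      obtain ⟨Z, hZs, hZl⟩ := P'.exists_append R
      have hRs : ∀ w ∈ R.support, w ∈ W.support := by grind
      have hRc := R.support_eq_cons
      have hRn : (v :: R.support.tail).Nodup := hRc ▸ hR
      have hRt : ∀ w ∈ R.support.tail, w ∈ W.support := fun w hw =>
        hRs w (List.mem_of_mem_tail hw)
      rw [List.nodup_cons] at hRn
      refine ⟨Z, ?_, by simp [hZl, hP'l, hPl, label, hl], ?_⟩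
      · rw [IsPath, hZs, hP's, List.nodup_append]
        refine ⟨hP, hRn.2, ?_⟩
        rintro w hw _ hw' rfl
        have := hPs w hw
        have := hWX w (hRt w hw')
        grind
      · intro w hw
        rw [hZs, hP's, List.mem_append] at hw
        simp only [support, List.mem_cons]
        grind

theorem noEquivArcs_contract2 {G H : LGraph V Γ} {X : Set V} {x y : V} (hxy : x ≠ y)
    (hG : G.NoEquivArcs) (hHa : H.arcs = G.contract2Arcs X x y) : H.NoEquivArcs := by
  rintro ⟨a₁, a₂, α⟩ ha ⟨b₁, b₂, β⟩ hb hab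
  rw [hHa] at ha hb
  rcases ha with ha | ⟨γ, -, hγ, hγ'⟩ <;> rcases hb with hb | ⟨δ, -, hδ, hδ'⟩
  · exact hG _ ha.1 _ hb.1 hab
  all_goals
    simp only [hasEquivArc, Prod.mk.injEq] at *
    grind [inv_inv]

end LGraph

open LGraph in
/-- For `(G, s, t) ∈ 𝒟` and a 2-contractible vertex set
`X ⊆ V(G)∖{s,t}` with `N_G(X) = {x, y}`, the 2-contraction `H = G /₂ X` satisfies
`(H, s, t) ∈ 𝒟` and `l(H; s, t) = l(G; s, t)`. -/
theorem two_contraction_preserves {V Γ : Type} [Group Γ] [DecidableEq V]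
    (G H : LGraph V Γ) (s t : V) (X : Set V) (x y : V)
    (hD : G.MemD s t)
    (hX : X ⊆ G.verts \ {s, t})
    (hxy : x ≠ y) (hN : G.nbhd X = {x, y})
    (hconn : (G.around X).Connected)
    (hne : G.around X ≠ G)
    (hHv : H.verts = G.verts \ X)
    (hHa : H.arcs = G.contract2Arcs X x y) :
    H.MemD s t ∧ labelSet H s t = labelSet G s t := by
  obtain ⟨hst, hs, ht, hcov, hE⟩ := hD
  have hsX : s ∉ X := fun h => (hX h).2 (Or.inl rfl)
  have htX : t ∉ X := fun h => (hX h).2 (Or.inr rfl)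
  have hsH : s ∈ H.verts := hHv ▸ ⟨hs, hsX⟩
  refine ⟨⟨hst, hsH, hHv ▸ ⟨ht, htX⟩, ?_, noEquivArcs_contract2 hxy hE hHa⟩, ?_⟩
  · intro v hv
    rw [hHv] at hv
    obtain ⟨P, hP, hvP⟩ := hcov v hv.1
    obtain ⟨R, hR, -, hRs⟩ := (P.exists_contract hxy hN hHa htX hP).1 hsX
    exact ⟨R, hR, (hRs v).2 ⟨hvP, hv.2⟩⟩
  · ext γ
    constructor
    · rintro ⟨P, hP, rfl⟩
      obtain ⟨R, hR, hl, -⟩ := P.exists_expand hN hHv hHa hsH hP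
      exact ⟨R, hR, hl⟩
    · rintro ⟨P, hP, rfl⟩
      obtain ⟨R, hR, hl, -⟩ := (P.exists_contract hxy hN hHa htX hP).1 hsX
      exact ⟨R, hR, hl⟩
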